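/- For every positive integer n with n ≡ 0 (mod 2) and n ≥ 4, Φ(2×n,3,1) = J*(2×n,3,1); explicitly, Φ(2×n,3,1) = ⌊2(n−1)/3⌋ − 1 if n ≡ 10 (mod 12), and Φ(2×n,3,1) = ⌊2(n−1)/3⌋ otherwise. -/

import Mathlib

/-- The cyclic shift of a codeword `B ⊆ I_m × Z_n` by `τ`. -/
def OOCshift {m n : ℕ} (B : Finset (Fin m × ZMod n)) (τ : ZMod n) :
    Finset (Fin m × ZMod n) :=
  B.image fun p => (p.1, p.2 + τ)

/-- A two-dimensional `(m × n, k, lam)` optical orthogonal code: a family of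
`k`-element codewords of `I_m × Z_n` with auto- and cross-correlation at most `lam`. -/
def IsOOC (m n k lam : ℕ) (C : Finset (Finset (Fin m × ZMod n))) : Prop :=
  (∀ A ∈ C, A.card = k) ∧
  (∀ A ∈ C, ∀ τ : ZMod n, τ ≠ 0 → (A ∩ OOCshift A τ).card ≤ lam) ∧
  (∀ A ∈ C, ∀ B ∈ C, A ≠ B → ∀ τ : ZMod n, (A ∩ OOCshift B τ).card ≤ lam)

/-- A family of words with pairwise distinct differences is an OOC. -/
lemma ooc_build (n : ℕ) (S : Finset ℕ) (w : ℕ → Fin 3 → Fin 2 × ZMod n)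
    (H : ∀ i ∈ S, ∀ j ∈ S, ∀ a b c d : Fin 3, a ≠ b → c ≠ d →
      (w i a).1 = (w j c).1 → (w i b).1 = (w j d).1 →
      (w i a).2 - (w i b).2 = (w j c).2 - (w j d).2 → i = j ∧ a = c) :
    ∃ C : Finset (Finset (Fin 2 × ZMod n)), IsOOC 2 n 3 1 C ∧ C.card = S.card := by
  have inj : ∀ i ∈ S, Function.Injective (w i) := by
    intro i hi a b hab
    by_contra hne
    exact hne (H i hi i hi a b b a hne (Ne.symm hne) (by rw [hab]) (by rw [hab])
      (by rw [hab])).2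
  have key : ∀ i ∈ S, ∀ j ∈ S, ∀ τ : ZMod n,
      1 < (Finset.univ.image (w i) ∩ OOCshift (Finset.univ.image (w j)) τ).card →
      i = j ∧ τ = 0 := by
    intro i hi j hj τ hc
    obtain ⟨x, hx, y, hy, hxy⟩ := Finset.one_lt_card.1 hc
    simp only [OOCshift, Finset.mem_inter, Finset.mem_image, Finset.mem_univ, true_and] at hx hy
    obtain ⟨⟨a, rfl⟩, z, ⟨c, rfl⟩, hz⟩ := hx
    obtain ⟨⟨b, rfl⟩, z', ⟨d, rfl⟩, hz'⟩ := hy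
    have h1 := congrArg Prod.fst hz
    have h2 := congrArg Prod.snd hz
    have h3 := congrArg Prod.fst hz'
    have h4 := congrArg Prod.snd hz'
    simp only at h1 h2 h3 h4
    have hab : a ≠ b := fun h => hxy (by rw [h])
    have hcd : c ≠ d := by
      rintro rfl
      exact hxy (hz.symm.trans hz')
    obtain ⟨rfl, rfl⟩ := H i hi j hj a b c d hab hcd h1.symm h3.symm
      (by rw [← h2, ← h4]; ring)
    exact ⟨rfl, by simpa using h2⟩
  have shift0 : ∀ A : Finset (Fin 2 × ZMod n), OOCshift A 0 = A := by
    intro A; simp [OOCshift]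
  have cardw : ∀ i ∈ S, (Finset.univ.image (w i)).card = 3 := by
    intro i hi
    rw [Finset.card_image_of_injective _ (inj i hi)]; simp
  refine ⟨S.image fun i => Finset.univ.image (w i), ⟨?_, ?_, ?_⟩, ?_⟩
  · intro A hA
    obtain ⟨i, hi, rfl⟩ := Finset.mem_image.1 hA
    exact cardw i hi
  · intro A hA τ hτ
    obtain ⟨i, hi, rfl⟩ := Finset.mem_image.1 hA
    by_contra hc
    exact hτ (key i hi i hi τ (by omega)).2
  · intro A hA B hB hAB τ
    obtain ⟨i, hi, rfl⟩ := Finset.mem_image.1 hA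
    obtain ⟨j, hj, rfl⟩ := Finset.mem_image.1 hB
    by_contra hc
    apply hAB
    rw [(key i hi j hj τ (by omega)).1]
  · apply Finset.card_image_of_injOn
    intro i hi j hj hij
    simp only at hij
    refine (key i hi j hj 0 ?_).1
    rw [shift0, ← hij, Finset.inter_self, cardw i hi]
    norm_num

/-- Lower position of the pair with difference `δ` in the zigzag arrangement. -/
def zig (c m δ : ℤ) : ℤ := if δ % 2 = 0 then c - δ / 2 else c + m - δ / 2

/-- Integer model of the code words. -/
def wInt (h m d e : ℤ) (k : ℤ) : Fin 3 → Fin 2 × ℤ :=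
  if k < m then ![(0, 0), (0, zig d m (k + 1)), (0, zig d m (k + 1) + (k + 1))]
  else if k < m + h - 1 then
    ![(0, 0), (1, zig e (h - 1) (k - m + 1)), (1, zig e (h - 1) (k - m + 1) + (k - m + 1))]
  else ![(0, 0), (0, e), (1, e)]

lemma wInt_range (h m d e k : ℤ) (hh : 2 ≤ h) (hm : 0 ≤ m) (he : e = (h + 1) / 2)
    (hd1 : m < d - m / 2) (hd2 : d + m / 2 + 2 * ((m + 1) / 2) ≤ h - 1) (hk : 0 ≤ k) 
    (a b : Fin 3) :
    ((wInt h m d e k a).1 = (wInt h m d e k b).1 →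
      -h < (wInt h m d e k a).2 - (wInt h m d e k b).2 ∧
      (wInt h m d e k a).2 - (wInt h m d e k b).2 < h) ∧
    ((wInt h m d e k a).1 = 1 → (wInt h m d e k b).1 = 0 →
      0 ≤ (wInt h m d e k a).2 - (wInt h m d e k b).2 ∧
      (wInt h m d e k a).2 - (wInt h m d e k b).2 < 2 * h) := by
  unfold wInt zig
  split_ifs <;> fin_cases a <;> fin_cases b <;> simp <;> omega

set_option maxHeartbeats 4000000 in
lemma wInt_inj (h m d e k l : ℤ) (hh : 2 ≤ h) (hm : 0 ≤ m) (he : e = (h + 1) / 2)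
    (hd1 : m < d - m / 2) (hd2 : d + m / 2 + 2 * ((m + 1) / 2) ≤ h - 1)
    (hk : 0 ≤ k) (hk' : k < m + h) (hl : 0 ≤ l) (hl' : l < m + h)
    (hke : k = m + h - 1 → d = e) (hle : l = m + h - 1 → d = e)
    (a b a' b' : Fin 3) (hab : a ≠ b) (hab' : a' ≠ b')
    (h1 : (wInt h m d e k a).1 = (wInt h m d e l a').1)
    (h2 : (wInt h m d e k b).1 = (wInt h m d e l b').1)
    (h3 : (wInt h m d e k a).2 - (wInt h m d e k b).2 =
      (wInt h m d e l a').2 - (wInt h m d e l b').2) : k = l ∧ a = a' := by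
  unfold wInt at h1 h2 h3
  split_ifs at h1 h2 h3 <;> fin_cases a <;> fin_cases b <;>
    first
    | exact absurd rfl hab
    | (fin_cases a' <;> fin_cases b' <;>
        first
        | exact absurd rfl hab'
        | (exfalso; simp at h1; done)
        | (exfalso; simp at h2; done)
        | (simp at h3; unfold zig at h3; simp; split_ifs at h3 <;> omega)
        | (simp at h3; unfold zig at h3; exfalso; split_ifs at h3 <;> omega)
        | (simp at h3; simp; omega)
        | (simp at h3; exfalso; omega))

lemma ooc_exists (n h m d e P : ℕ) (hn : n = 2 * h) (hh : 2 ≤ h) (he : e = (h + 1) / 2)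
    (hd1 : m < d - m / 2) (hd2 : d + m / 2 + 2 * ((m + 1) / 2) ≤ h - 1)
    (hP : P ≤ m + h) (hPe : P = m + h → d = e) :
    ∃ C : Finset (Finset (Fin 2 × ZMod n)), IsOOC 2 n 3 1 C ∧ C.card = P := by
  obtain ⟨C, hC, hc⟩ := ooc_build n (Finset.range P)
    (fun k a => ((wInt h m d e k a).1, ((wInt h m d e k a).2 : ZMod n))) (by
      intro i hi j hj a b a' b' hab hab' h1 h2 h3
      simp only at h1 h2 h3
      rw [Finset.mem_range] at hi hj
      have hd1' : (m : ℤ) < d - m / 2 := by omega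
      have hd2' : (d : ℤ) + m / 2 + 2 * ((m + 1) / 2) ≤ h - 1 := by omega
      have r1 := wInt_range h m d e i (by omega) (by omega) (by omega) hd1' hd2' (by omega)
      have r2 := wInt_range h m d e j (by omega) (by omega) (by omega) hd1' hd2' (by omega)
      rw [← Int.cast_sub, ← Int.cast_sub, ZMod.intCast_eq_intCast_iff_dvd_sub] at h3
      have h3' : (wInt h m d e i a).2 - (wInt h m d e i b).2 =
          (wInt h m d e j a').2 - (wInt h m d e j b').2 := by
        have q1 := (r1 a b).1
        have q2 := (r1 a b).2
        have q3 := (r1 b a).2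
        have q4 := (r2 a' b').1
        have q5 := (r2 a' b').2
        have q6 := (r2 b' a').2
        rw [← h1, ← h2] at q4 q5
        rw [← h1, ← h2] at q6
        obtain ⟨t, ht⟩ := h3
        have bd : |(wInt h m d e j a').2 - (wInt h m d e j b').2 -
            ((wInt h m d e i a).2 - (wInt h m d e i b).2)| < 2 * h := by
          rw [abs_lt]
          have f2 : ∀ x : Fin 2, x = 0 ∨ x = 1 := by decide
          rcases f2 (wInt h m d e i a).1 with u | u <;>
            rcases f2 (wInt h m d e i b).1 with v | v <;>
            simp only [u, v] at q1 q2 q3 q4 q5 q6 <;> simp at q1 q2 q3 q4 q5 q6 <;> omega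
        have := Int.eq_zero_of_abs_lt_dvd (m := 2 * (h : ℤ)) ⟨t, by rw [ht, hn]; push_cast; ring⟩ bd
        omega
      have := wInt_inj h m d e i j (by omega) (by omega) (by omega) hd1' hd2' (by omega)
        (by omega) (by omega) (by omega) (by omega) (by omega) a b a' b' hab hab' h1 h2 h3'
      exact ⟨by omega, this.2⟩)
  exact ⟨C, hC, by simpa using hc⟩

/-- The difference of an ordered pair of points. -/
def dmap (n : ℕ) (s : (_ : Finset (Fin 2 × ZMod n)) × ((Fin 2 × ZMod n) × (Fin 2 × ZMod n))) :
    Fin 2 × Fin 2 × ZMod n :=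
  (s.2.1.1, s.2.2.1, s.2.1.2 - s.2.2.2)

/-- The differences which cannot occur. -/
def badD (n : ℕ) : Finset (Fin 2 × Fin 2 × ZMod n) :=
  {(0, 0, 0), (1, 1, 0), (0, 0, ((n / 2 : ℕ) : ZMod n)), (1, 1, ((n / 2 : ℕ) : ZMod n))}

lemma two_common {n : ℕ} {C : Finset (Finset (Fin 2 × ZMod n))} (hC : IsOOC 2 n 3 1 C)
    {A B : Finset (Fin 2 × ZMod n)} (hA : A ∈ C) (hB : B ∈ C) {x y z w : Fin 2 × ZMod n}
    (hx : x ∈ A) (hy : y ∈ A) (hz : z ∈ B) (hw : w ∈ B) (hxy : x ≠ y)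
    (h1 : x.1 = z.1) (h2 : y.1 = w.1) (h3 : x.2 - y.2 = z.2 - w.2) :
    A = B ∧ x = z ∧ y = w := by
  have hc : 1 < (A ∩ OOCshift B (x.2 - z.2)).card := by
    refine Finset.one_lt_card.2 ⟨x, ?_, y, ?_, hxy⟩
    · refine Finset.mem_inter.2 ⟨hx, Finset.mem_image.2 ⟨z, hz, ?_⟩⟩
      ext1
      · exact h1.symm
      · simp
    · refine Finset.mem_inter.2 ⟨hy, Finset.mem_image.2 ⟨w, hw, ?_⟩⟩
      ext1
      · exact h2.symm
      · show w.2 + (x.2 - z.2) = y.2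
        linear_combination h3
  have hAB : A = B := by
    by_contra hne
    have := hC.2.2 A hA B hB hne (x.2 - z.2)
    omega
  subst hAB
  have ht : x.2 - z.2 = 0 := by
    by_contra hne
    have := hC.2.1 A hA (x.2 - z.2) hne
    omega
  refine ⟨rfl, Prod.ext h1 (sub_eq_zero.1 ht), Prod.ext h2 ?_⟩
  linear_combination ht - h3

lemma half_add {n : ℕ} (hn2 : n % 2 = 0) :
    ((n / 2 : ℕ) : ZMod n) + ((n / 2 : ℕ) : ZMod n) = 0 := by
  rw [← Nat.cast_add, show n / 2 + n / 2 = n by omega]; simp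

lemma half_ne {n : ℕ} (hn4 : 4 ≤ n) : ((n / 2 : ℕ) : ZMod n) ≠ 0 := by
  rw [Ne, ZMod.natCast_eq_zero_iff]
  intro h
  have := Nat.le_of_dvd (by omega) h
  omega

lemma badD_card {n : ℕ} (hn4 : 4 ≤ n) : (badD n).card = 4 := by
  have := half_ne hn4
  have h' := this.symm
  unfold badD
  rw [Finset.card_insert_of_notMem, Finset.card_insert_of_notMem, Finset.card_insert_of_notMem,
    Finset.card_singleton] <;> simp [h']

lemma dmap_inj {n : ℕ} {C : Finset (Finset (Fin 2 × ZMod n))} (hC : IsOOC 2 n 3 1 C) :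
    Set.InjOn (dmap n) (C.sigma fun A => A.offDiag : Finset _) := by
  rintro ⟨A, x, y⟩ hs ⟨B, z, w⟩ ht hst
  simp only [Finset.coe_sigma, Set.mem_sigma_iff, Finset.mem_coe, Finset.mem_offDiag] at hs ht
  simp only [dmap, Prod.mk.injEq] at hst
  obtain ⟨hA, hx, hy, hxy⟩ := hs
  obtain ⟨hB, hz, hw, hzw⟩ := ht
  obtain ⟨rfl, rfl, rfl⟩ := two_common hC hA hB hx hy hz hw hxy hst.1 hst.2.1 hst.2.2
  rfl

lemma dmap_maps {n : ℕ} (hn2 : n % 2 = 0) {C : Finset (Finset (Fin 2 × ZMod n))} (hC : IsOOC 2 n 3 1 C) :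
    ∀ s ∈ C.sigma fun A => A.offDiag, dmap n s ∉ badD n := by
  rintro ⟨A, x, y⟩ hs hb
  simp only [Finset.mem_sigma, Finset.mem_offDiag] at hs
  obtain ⟨hA, hx, hy, hxy⟩ := hs
  have hrow : x.1 = y.1 ∧ (x.2 - y.2 = 0 ∨ x.2 - y.2 = ((n / 2 : ℕ) : ZMod n)) := by
    simp only [badD, dmap, Finset.mem_insert, Finset.mem_singleton, Prod.mk.injEq] at hb
    rcases hb with h | h | h | h
    · exact ⟨h.1.trans h.2.1.symm, Or.inl h.2.2⟩
    · exact ⟨h.1.trans h.2.1.symm, Or.inl h.2.2⟩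
    · exact ⟨h.1.trans h.2.1.symm, Or.inr h.2.2⟩
    · exact ⟨h.1.trans h.2.1.symm, Or.inr h.2.2⟩
  obtain ⟨h1, h2⟩ := hrow
  have h3 : x.2 - y.2 = y.2 - x.2 := by
    rcases h2 with h | h
    · linear_combination 2 * h
    · have := half_add hn2
      linear_combination 2 * h + this
  exact hxy (two_common hC hA hA hx hy hy hx hxy h1 h1.symm h3).2.1

lemma sigma_card {n : ℕ} {C : Finset (Finset (Fin 2 × ZMod n))} (hC : IsOOC 2 n 3 1 C) :
    (C.sigma fun A => A.offDiag).card = 6 * C.card := by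
  rw [Finset.card_sigma, Finset.sum_congr rfl (g := fun _ => 6)]
  · simp [mul_comm]
  · intro A hA
    rw [Finset.offDiag_card, hC.1 A hA]

lemma compl_card {n : ℕ} (hn4 : 4 ≤ n) [NeZero n] : ((badD n)ᶜ).card = 4 * n - 4 := by
  rw [Finset.card_compl, badD_card hn4]
  simp [ZMod.card]
  omega

lemma johnson {n : ℕ} (hn2 : n % 2 = 0) (hn4 : 4 ≤ n) {C : Finset (Finset (Fin 2 × ZMod n))}
    (hC : IsOOC 2 n 3 1 C) : 6 * C.card ≤ 4 * n - 4 := by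
  haveI : NeZero n := ⟨by omega⟩
  rw [← sigma_card hC, ← compl_card hn4]
  exact Finset.card_le_card_of_injOn (dmap n)
    (fun s hs => by simpa using dmap_maps hn2 hC s hs) (dmap_inj hC)

/-- Parity indicator. -/
def par (a : ZMod 2) : ℕ := if a = 0 then 0 else 1

lemma par_sum3 : ∀ a b c : ZMod 2, 
    4 ∣ (par (a - b) + par (a - c)) + ((par (b - a) + par (b - c)) + (par (c - a) + par (c - b))) := by
  decide

lemma parity {n : ℕ} (hn2 : n % 12 = 10) {C : Finset (Finset (Fin 2 × ZMod n))}
    (hC : IsOOC 2 n 3 1 C) : 6 * C.card ≠ 4 * n - 4 := by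
  intro hcard
  haveI : NeZero n := ⟨by omega⟩
  have hn4 : 4 ≤ n := by omega
  have hd : 2 ∣ n := by omega
  let χ : ZMod n →+* ZMod 2 := ZMod.castHom hd (ZMod 2)
  let g : Fin 2 × Fin 2 × ZMod n → ℕ := fun v => par (χ v.2.2)
  have himg : (C.sigma fun A => A.offDiag).image (dmap n) = (badD n)ᶜ := by
    apply Finset.eq_of_subset_of_card_le
    · intro v hv
      obtain ⟨s, hs, rfl⟩ := Finset.mem_image.1 hv
      simpa using dmap_maps (by omega) hC s hs
    · rw [Finset.card_image_of_injOn (dmap_inj hC), sigma_card hC, compl_card hn4, hcard]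
  have hsum : ∑ v ∈ (badD n)ᶜ, g v = ∑ A ∈ C, ∑ p ∈ A.offDiag, par (χ p.1.2 - χ p.2.2) := by
    rw [← himg, Finset.sum_image (dmap_inj hC), Finset.sum_sigma]
    simp [g, dmap]
  have h4 : 4 ∣ ∑ v ∈ (badD n)ᶜ, g v := by
    rw [hsum]
    apply Finset.dvd_sum
    intro A hA
    obtain ⟨x, y, z, hxy, hxz, hyz, rfl⟩ := Finset.card_eq_three.1 (hC.1 A hA)
    have : ∑ p ∈ ({x, y, z} : Finset (Fin 2 × ZMod n)).offDiag, par (χ p.1.2 - χ p.2.2)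
        = ∑ p ∈ ({x, y, z} : Finset (Fin 2 × ZMod n)) ×ˢ {x, y, z}, par (χ p.1.2 - χ p.2.2) := by
      apply Finset.sum_subset
      · intro p hp
        rw [Finset.mem_offDiag] at hp
        exact Finset.mem_product.2 ⟨hp.1, hp.2.1⟩
      · intro p hp hp'
        rw [Finset.mem_product] at hp
        rw [Finset.mem_offDiag] at hp'
        have : p.1 = p.2 := by
          by_contra hne
          exact hp' ⟨hp.1, hp.2, hne⟩
        rw [this]; simp [par]
    rw [this, Finset.sum_product]
    have e3 : ∀ f : Fin 2 × ZMod n → ℕ, ∑ u ∈ ({x, y, z} : Finset (Fin 2 × ZMod n)), f u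
        = f x + (f y + f z) := by
      intro f
      rw [Finset.sum_insert (by simp [hxy, hxz]), Finset.sum_insert (by simp [hyz]),
        Finset.sum_singleton]
    simp only [e3]
    have := par_sum3 (χ x.2) (χ y.2) (χ z.2)
    have p0 : par 0 = 0 := rfl
    simp only [sub_self, p0]
    omega
  have htot : ∑ v ∈ (badD n)ᶜ, g v + ∑ v ∈ badD n, g v = ∑ v, g v :=
    Finset.sum_compl_add_sum _ _
  have hall : ∑ v, g v = 4 * ∑ v : ZMod n, par (χ v) := by
    simp [g, Fintype.sum_prod_type]
    ring
  have hodd : 2 * ∑ v : ZMod n, par (χ v) = n := by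
    have e1 : ∑ v : ZMod n, par (χ (v + 1)) = ∑ v : ZMod n, par (χ v) :=
      Equiv.sum_comp (Equiv.addRight (1 : ZMod n)) (fun v => par (χ v))
    have e2 : ∀ a : ZMod 2, par a + par (a + 1) = 1 := by decide
    rw [two_mul]
    nth_rewrite 2 [← e1]
    rw [← Finset.sum_add_distrib]
    simp [e2, ZMod.card]
  have hbad : ∑ v ∈ badD n, g v = 2 := by
    have h' := (half_ne hn4).symm
    have hχ : par (χ ((n / 2 : ℕ) : ZMod n)) = 1 := by
      rw [map_natCast, ← Nat.mod_add_div (n / 2) 2, show n / 2 % 2 = 1 by omega]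
      have : (2 : ZMod 2) = 0 := rfl
      push_cast
      rw [this]
      simp [par]
    have p0 : par 0 = 0 := rfl
    unfold badD
    rw [Finset.sum_insert, Finset.sum_insert, Finset.sum_insert, Finset.sum_singleton]
    · simp [g, hχ, map_zero, p0]
    all_goals simp [h']
  obtain ⟨t, ht⟩ := h4
  omega

theorem stmt_18 (n : ℕ) (hn2 : n % 2 = 0) (hn4 : 4 ≤ n) (Phi : ℕ)
    (hPhi : Phi = if n % 12 = 10 then 2 * (n - 1) / 3 - 1 else 2 * (n - 1) / 3) :
    (∃ C : Finset (Finset (Fin 2 × ZMod n)), IsOOC 2 n 3 1 C ∧ C.card = Phi) ∧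
    (∀ C : Finset (Finset (Fin 2 × ZMod n)), IsOOC 2 n 3 1 C → C.card ≤ Phi) := by
  constructor
  · obtain ⟨h, rfl⟩ : ∃ h, n = 2 * h := ⟨n / 2, by omega⟩
    by_cases h10 : 2 * h % 12 = 10
    · rw [if_pos h10] at hPhi
      obtain ⟨s, rfl⟩ : ∃ s, h = 6 * s + 5 := ⟨h / 6, by omega⟩
      exact ooc_exists _ (6 * s + 5) (2 * s + 1) (3 * s + 2) _ Phi rfl (by omega) rfl
        (by omega) (by omega) (by omega) (by omega)
    · rw [if_neg h10] at hPhi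
      obtain ⟨s, r, hr, rfl⟩ : ∃ s r, r < 6 ∧ h = 6 * s + r := ⟨h / 6, h % 6, by omega, by omega⟩
      refine ooc_exists _ (6 * s + r) ((6 * s + r - 2) / 3) ((6 * s + r + 1) / 2) _ Phi rfl
        (by omega) rfl ?_ ?_ ?_ ?_ <;> interval_cases r <;> omega
  · intro C hC
    have hj := johnson hn2 hn4 hC
    split_ifs at hPhi with h10
    · have := parity h10 hC
      omega
    · omega
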